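/- For all τ > 0, the recurrence set R_τ belongs to the large intersection class 𝒢^{s₀}(𝕋²), where s₀ = min{ 2log|λ₂|/(τ + log|λ₂|), log|λ₂|/τ }; in particular, any countable intersection of images of R_τ under similarities has Hausdorff dimension at least s₀. -/

import Mathlib

open Filter MeasureTheory

noncomputable def intVec (z : Fin 2 → ℤ) : EuclideanSpace ℝ (Fin 2) :=
  (WithLp.equiv 2 (Fin 2 → ℝ)).symm fun i => (z i : ℝ)

/-- The lift to `ℝ²` of the recurrence set
`R_τ = {x ∈ 𝕋² : Tⁿx ∈ B(x, e^{-nτ}) for infinitely many n}`, where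
`T x = A x (mod 1)`:  `Tⁿx ∈ B(x, e^{-nτ})` iff `‖Aⁿx - x - z‖ < e^{-nτ}`
for some `z ∈ ℤ²`. -/
noncomputable def recSet (A : Matrix (Fin 2) (Fin 2) ℤ) (τ : ℝ) :
    Set (EuclideanSpace ℝ (Fin 2)) :=
  {x | ∃ᶠ n : ℕ in atTop, ∃ z : Fin 2 → ℤ,
    ‖Matrix.toEuclideanLin ((A ^ n).map (Int.cast : ℤ → ℝ)) x - x - intVec z‖
      < Real.exp (-(n : ℝ) * τ)}

section Auxiliary

open scoped ENNReal NNReal Topology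

theorem lintegral_eq_lintegral_lintegral_add {E : Type*} [NormedAddCommGroup E]
    [MeasurableSpace E] [BorelSpace E] {μ ν : Measure E} [μ.IsAddRightInvariant]
    [IsProbabilityMeasure ν] (F : E → ℝ≥0∞) :
    ∫⁻ y, F y ∂μ = ∫⁻ t, ∫⁻ y, F (y + t) ∂μ ∂ν := by
  simp [lintegral_add_right_eq_self]

section Abstract
variable {E : Type*} [NormedAddCommGroup E] [MeasurableSpace E] [BorelSpace E]
  [SecondCountableTopology E]

theorem lintegral_lintegral_mul_eq_of_average {μ ν : Measure E} [SFinite μ] [SFinite ν]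
    {h : E → ℝ≥0} (hm : Continuous h) (hh : ∀ x, ∫⁻ t, (h (x + t) : ℝ≥0∞) ∂ν = 1)
    {G : E → ℝ≥0∞} (hG : Measurable G) :
    ∫⁻ t, ∫⁻ y, G y * h (y + t) ∂μ ∂ν = ∫⁻ y, G y ∂μ := by
  have h1 : Measurable fun p : E × E => h (p.2 + p.1) := (hm.comp (by fun_prop)).measurable
  rw [lintegral_lintegral_swap
    ((hG.comp measurable_snd).mul h1.coe_nnreal_ennreal).aemeasurable]
  congr 1; ext y
  rw [lintegral_const_mul _ (by
    exact (hm.comp (by fun_prop : Continuous fun t => y + t)).measurable.coe_nnreal_ennreal),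
    hh, mul_one]

theorem lintegral_mul_le_of_average {μ ν : Measure E} [SFinite μ] [μ.IsAddRightInvariant]
    [IsProbabilityMeasure ν] {h : E → ℝ≥0} (hm : Continuous h) {η : ℝ}
    (hν : ∀ᵐ t ∂ν, ‖t‖ ≤ η) (hh : ∀ x, ∫⁻ t, (h (x + t) : ℝ≥0∞) ∂ν = 1)
    {F G : E → ℝ≥0∞} (hG : Measurable G) (H : ∀ y t, ‖t‖ ≤ η → F (y + t) ≤ G y) :
    ∫⁻ y, F y * h y ∂μ ≤ ∫⁻ y, G y ∂μ := by
  rw [lintegral_eq_lintegral_lintegral_add (ν := ν),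
    ← lintegral_lintegral_mul_eq_of_average hm hh hG]
  refine lintegral_mono_ae (hν.mono fun t ht => lintegral_mono fun y => ?_)
  exact mul_le_mul_left (H y t ht) _

theorem le_lintegral_mul_of_average {μ ν : Measure E} [SFinite μ] [μ.IsAddRightInvariant]
    [IsProbabilityMeasure ν] {h : E → ℝ≥0} (hm : Continuous h) {η : ℝ}
    (hν : ∀ᵐ t ∂ν, ‖t‖ ≤ η) (hh : ∀ x, ∫⁻ t, (h (x + t) : ℝ≥0∞) ∂ν = 1)
    {F G : E → ℝ≥0∞} (hG : Measurable G) (H : ∀ y t, ‖t‖ ≤ η → G y ≤ F (y + t)) :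
    ∫⁻ y, G y ∂μ ≤ ∫⁻ y, F y * h y ∂μ := by
  rw [lintegral_eq_lintegral_lintegral_add (ν := ν) (fun y => F y * h y),
    ← lintegral_lintegral_mul_eq_of_average hm hh hG]
  refine lintegral_mono_ae (hν.mono fun t ht => lintegral_mono fun y => ?_)
  exact mul_le_mul_left (H y t ht) _

end Abstract

theorem le_dimH_of_frostman {E : Type*} [MetricSpace E] [MeasurableSpace E] [BorelSpace E]
    {s : ℝ} (hs : 0 < s) {K : ℕ → Set E} (hK : ∀ k, IsCompact (K k)) (hanti : Antitone K)
    (μ : ℕ → Measure E) {C m : ℝ≥0∞} (hC : C ≠ ∞) (hm : 0 < m)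
    (hμm : ∀ k, m ≤ μ k (K k))
    (hμC : ∀ k x r, 0 < r → μ k (Metric.ball x r) ≤ C * ENNReal.ofReal (r ^ s)) :
    ENNReal.ofReal s ≤ dimH (⋂ k, K k) := by
  have key : μH[s] (⋂ k, K k) ≠ 0 := by
    intro h0
    rw [Measure.hausdorffMeasure_apply] at h0
    simp only [ENNReal.iSup_eq_zero] at h0
    have h1 := h0 1 one_pos
    obtain ⟨ε, hε, hεm⟩ : ∃ ε : ℝ≥0, 0 < ε ∧ C * (ε + ε) < m := by
      have : Tendsto (fun ε : ℝ≥0 => C * ((ε : ℝ≥0∞) + ε)) (𝓝 0) (𝓝 (C * ((0:ℝ≥0) + (0:ℝ≥0)))) := by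
        refine ENNReal.Tendsto.const_mul ?_ (Or.inr hC)
        refine Tendsto.add ?_ ?_ <;> exact ENNReal.tendsto_coe.2 tendsto_id
      simp only [ENNReal.coe_zero, add_zero, mul_zero] at this
      have h2 := (this.eventually (gt_mem_nhds hm))
      have h3 : ∀ᶠ ε : ℝ≥0 in 𝓝[>] 0, 0 < ε := self_mem_nhdsWithin
      obtain ⟨ε, h4, h5⟩ := ((h2.filter_mono nhdsWithin_le_nhds).and h3).exists
      exact ⟨ε, h5, h4⟩
    have h2 : (⨅ (t : ℕ → Set E) (_ : ⋂ k, K k ⊆ ⋃ n, t n) (_ : ∀ n, Metric.ediam (t n) ≤ 1),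
      ∑' n, ⨆ _ : (t n).Nonempty, Metric.ediam (t n) ^ s) < ε := by
      rw [h1]; exact_mod_cast hε
    simp only [iInf_lt_iff] at h2
    obtain ⟨t, htK, htd, hsum⟩ := h2
    obtain ⟨ε', hε', hε's⟩ := ENNReal.exists_pos_sum_of_countable
      (ENNReal.coe_ne_zero.2 hε.ne') ℕ
    have hball : ∀ n, ∃ U : Set E, IsOpen U ∧ t n ⊆ U ∧
        ∀ k, μ k U ≤ C * ((⨆ _ : (t n).Nonempty, Metric.ediam (t n) ^ s) + ε' n) := by
      intro n
      rcases (t n).eq_empty_or_nonempty with he | ⟨x, hx⟩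
      · exact ⟨∅, isOpen_empty, he.subset, fun k => by simp⟩
      have hdt : Metric.ediam (t n) ≠ ∞ := ne_top_of_le_ne_top ENNReal.one_ne_top (htd n)
      set d := (Metric.ediam (t n)).toReal with hd
      have hd0 : 0 ≤ d := ENNReal.toReal_nonneg
      have hcont : ContinuousAt (fun η : ℝ => (d + η) ^ s) 0 := by
        refine ContinuousAt.rpow_const (by fun_prop) (Or.inr hs.le)
      have h3 : ∀ᶠ η in 𝓝 (0:ℝ), (d + η) ^ s < d ^ s + ε' n := by
        refine hcont.eventually (gt_mem_nhds ?_)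
        simp [hε' n]
      have h4 : ∀ᶠ η : ℝ in 𝓝[>] 0, 0 < η := self_mem_nhdsWithin
      obtain ⟨η, h5, h6⟩ := ((h3.filter_mono nhdsWithin_le_nhds).and h4).exists
      refine ⟨Metric.ball x (d + η), Metric.isOpen_ball, fun y hy => ?_, fun k => ?_⟩
      · have := Metric.edist_le_ediam_of_mem hy hx
        have h7 : dist y x ≤ d := by
          rw [dist_edist]; exact ENNReal.toReal_mono hdt this
        rw [Metric.mem_ball]; linarith
      · refine (hμC k x (d + η) (by linarith)).trans ?_
        gcongr
        refine (ENNReal.ofReal_le_ofReal h5.le).trans ?_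
        rw [ENNReal.ofReal_add (by positivity) (by positivity), ENNReal.ofReal_coe_nnreal]
        gcongr
        have : (t n).Nonempty := ⟨x, hx⟩
        simp only [this, iSup_pos]
        rw [← ENNReal.ofReal_rpow_of_nonneg hd0 hs.le, hd, ENNReal.ofReal_toReal hdt]
    choose U hUo hUt hUμ using hball
    obtain ⟨k, hk⟩ := exists_subset_nhds_of_isCompact hanti.directed_ge hK
      (U := ⋃ n, U n) (fun x hx => (isOpen_iUnion hUo).mem_nhds
        ((htK.trans (Set.iUnion_mono hUt)) hx))
    have : m ≤ C * (ε + ε) := by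
      calc m ≤ μ k (K k) := hμm k
        _ ≤ μ k (⋃ n, U n) := measure_mono hk
        _ ≤ ∑' n, μ k (U n) := measure_iUnion_le _
        _ ≤ ∑' n, C * ((⨆ _ : (t n).Nonempty, Metric.ediam (t n) ^ s) + ε' n) :=
            ENNReal.tsum_le_tsum fun n => hUμ n k
        _ = C * ((∑' n, ⨆ _ : (t n).Nonempty, Metric.ediam (t n) ^ s) + ∑' n, (ε' n : ℝ≥0∞)) := by
            rw [ENNReal.tsum_mul_left, ENNReal.tsum_add]
        _ ≤ C * (ε + ε) := by gcongr
    exact absurd this (not_le.2 hεm)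
  have := le_dimH_of_hausdorffMeasure_ne_zero (d := s.toNNReal) (by
    rwa [Real.coe_toNNReal s hs.le])
  exact this

theorem eventually_ball_le_of_average {E : Type*} [NormedAddCommGroup E] [NormedSpace ℝ E]
    [FiniteDimensional ℝ E] [MeasurableSpace E] [BorelSpace E] {μ : Measure E}
    [μ.IsAddHaarMeasure] {φ : E → ℝ≥0} (hφ : Continuous φ) (hφc : HasCompactSupport φ)
    {s s' : ℝ} (hs : 0 < s) (hss' : s < s') {h : ℕ → E → ℝ≥0} (hcont : ∀ n, Continuous (h n))
    {C : ℝ≥0} (hC : ∀ᶠ n in atTop, ∀ x r, 0 < r → r ≤ 1 →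
      ∫⁻ y in Metric.ball x r, h n y ∂μ ≤ C * ENNReal.ofReal (r ^ s'))
    (hav : ∀ η > 0, ∀ᶠ n in atTop, ∃ ν : Measure E, IsProbabilityMeasure ν ∧
      (∀ᵐ t ∂ν, ‖t‖ ≤ η) ∧ ∀ x, ∫⁻ t, h n (x + t) ∂ν = 1)
    {c ε : ℝ≥0} (hc : ∀ x r, 0 < r →
      ∫⁻ y in Metric.ball x r, φ y ∂μ ≤ c * ENNReal.ofReal (r ^ s)) (hε : 0 < ε) :
    ∀ᶠ n in atTop, (∀ x r, 0 < r →
      ∫⁻ y in Metric.ball x r, φ y * h n y ∂μ ≤ (c + ε) * ENNReal.ofReal (r ^ s)) ∧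
      ∫⁻ y, φ y ∂μ ≤ ∫⁻ y, φ y * h n y ∂μ + ε := by
  have : ProperSpace E := FiniteDimensional.proper ℝ E
  obtain ⟨B, hB⟩ : ∃ B : ℝ≥0, ∀ x, φ x ≤ B := by
    obtain ⟨B, hB⟩ := (hφc.comp_left (g := ((↑) : ℝ≥0 → ℝ))
      NNReal.coe_zero).exists_bound_of_continuous (by fun_prop)
    exact ⟨B.toNNReal, fun x => by
      have := hB x
      simp at this
      exact NNReal.le_toNNReal_of_coe_le this⟩
  set K := tsupport φ with hK
  set K' := Metric.cthickening 1 K with hK'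
  have hK'c : IsCompact K' := IsCompact.cthickening hφc
  have hK'm : MeasurableSet K' := hK'c.isClosed.measurableSet
  set W : ℝ≥0 := (μ K').toNNReal with hW
  have hWc : (W : ℝ≥0∞) = μ K' := ENNReal.coe_toNNReal hK'c.measure_lt_top.ne
  obtain ⟨δ, hδ0, hδ1, hδ⟩ : ∃ δ : ℝ, 0 < δ ∧ δ ≤ 1 ∧ B * C * δ ^ (s' - s) ≤ ε := by
    have h1 : Tendsto (fun δ : ℝ => B * C * δ ^ (s' - s)) (𝓝 0) (𝓝 (B * C * 0 ^ (s' - s))) :=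
      ((Real.continuousAt_rpow_const 0 _ (Or.inr (by linarith))).tendsto).const_mul _
    rw [Real.zero_rpow (by linarith), mul_zero] at h1
    have h2 : ∀ᶠ δ : ℝ in 𝓝[>] 0, 0 < δ := self_mem_nhdsWithin
    obtain ⟨δ, ⟨h3, h4⟩, h5⟩ := ((((h1.eventually (gt_mem_nhds (NNReal.coe_pos.2 hε))).and
      (gt_mem_nhds one_pos)).filter_mono nhdsWithin_le_nhds).and h2).exists
    exact ⟨δ, h5, h4.le, h3.le⟩
  obtain ⟨ω, hω0, hω⟩ : ∃ ω : ℝ≥0, 0 < ω ∧ ω * W ≤ ε / 2 * δ ^ s := by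
    have hp : 0 < δ ^ s := Real.rpow_pos_of_pos hδ0 _
    refine ⟨(ε / 2 * δ ^ s / (W + 1)).toNNReal, ?_, ?_⟩
    · rw [Real.toNNReal_pos]; positivity
    · rw [Real.coe_toNNReal _ (by positivity), div_mul_eq_mul_div, div_le_iff₀ (by positivity)]
      gcongr; linarith
  have hδs : δ ^ s ≤ 1 := Real.rpow_le_one hδ0.le hδ1 hs.le
  have hωε : ω * W ≤ ε := by
    have : (ω * W : ℝ) ≤ ε := by nlinarith [ε.coe_nonneg]
    exact_mod_cast this
  obtain ⟨η, hη0, hη1, hηφ, hηc⟩ : ∃ η : ℝ, 0 < η ∧ η ≤ 1 ∧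
      (∀ y t, ‖t‖ ≤ η → dist (φ (y + t)) (φ y) ≤ ω) ∧ c * (1 + η / δ) ^ s ≤ c + ε / 2 := by
    have huc : UniformContinuous φ := hφc.uniformContinuous_of_continuous hφ
    obtain ⟨η₀, h1, h2⟩ := Metric.uniformContinuous_iff.1 huc ω (by exact_mod_cast hω0)
    have h3 : Tendsto (fun η : ℝ => c * (1 + η / δ) ^ s) (𝓝 0) (𝓝 (c * (1 + 0 / δ) ^ s)) := by
      refine Tendsto.const_mul _ (Tendsto.rpow_const ?_ (Or.inr hs.le))
      exact (continuous_const.add (continuous_id.div_const _)).tendsto 0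
    simp only [zero_div, add_zero, Real.one_rpow, mul_one] at h3
    have h4 : ∀ᶠ δ : ℝ in 𝓝[>] 0, 0 < δ := self_mem_nhdsWithin
    obtain ⟨η, ⟨⟨h5, h6⟩, h7⟩, h8⟩ := (((((h3.eventually (gt_mem_nhds
      (show (c : ℝ) < c + ε / 2 by simpa using hε))).and
      (gt_mem_nhds one_pos)).and (gt_mem_nhds h1)).filter_mono nhdsWithin_le_nhds).and h4).exists
    refine ⟨η, h8, h6.le, fun y t ht => (h2 ?_).le, h5.le⟩
    simpa using ht.trans_lt h7
  have hsub : ∀ y t, ‖t‖ ≤ η → φ (y + t) ≠ 0 → y ∈ K' := fun y t ht hne => by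
    refine Metric.mem_cthickening_of_dist_le y (y + t) 1 K (subset_tsupport _ hne) ?_
    simpa using ht.trans hη1
  have hcl : ∀ y t, ‖t‖ ≤ η → φ (y + t) ≤ φ y + ω ∧ φ y ≤ φ (y + t) + ω := fun y t ht => by
    have := hηφ y t ht
    rw [NNReal.dist_eq, abs_le] at this
    constructor
    · have : (φ (y + t) : ℝ) ≤ φ y + ω := by linarith
      exact_mod_cast this
    · have : (φ y : ℝ) ≤ φ (y + t) + ω := by linarith
      exact_mod_cast this
  have hφm : Measurable fun y => (φ y : ℝ≥0∞) := hφ.measurable.coe_nnreal_ennreal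
  have hind : ∫⁻ y, K'.indicator (fun _ => (ω : ℝ≥0∞)) y ∂μ = ω * W := by
    rw [lintegral_indicator hK'm, setLIntegral_const, hWc]
  filter_upwards [hC, hav η hη0] with n hCn ⟨ν, hν, hνη, hν1⟩
  refine ⟨fun x r hr => ?_, ?_⟩
  · rcases le_total r δ with hrδ | hrδ
    · calc ∫⁻ y in Metric.ball x r, φ y * h n y ∂μ
          ≤ ∫⁻ y in Metric.ball x r, B * h n y ∂μ := by
            gcongr with y; exact hB y
        _ ≤ B * (C * ENNReal.ofReal (r ^ s')) := by
            rw [lintegral_const_mul _ (hcont n).measurable.coe_nnreal_ennreal]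
            gcongr
            exact hCn x r hr (hrδ.trans hδ1)
        _ = ENNReal.ofReal (B * C * r ^ (s' - s)) * ENNReal.ofReal (r ^ s) := by
            rw [← ENNReal.ofReal_mul (by positivity), mul_assoc, mul_assoc (B : ℝ),
              ← Real.rpow_add hr, sub_add_cancel, ENNReal.ofReal_mul (by positivity),
              ENNReal.ofReal_mul (by positivity)]
            simp
        _ ≤ (c + ε) * ENNReal.ofReal (r ^ s) := by
            gcongr
            have : B * C * r ^ (s' - s) ≤ ε := by
              refine le_trans ?_ hδ
              gcongr
            calc ENNReal.ofReal (B * C * r ^ (s' - s)) ≤ ENNReal.ofReal ε :=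
                  ENNReal.ofReal_le_ofReal this
              _ = ε := by simp
              _ ≤ c + ε := le_add_self
    · have hreal : c * (r + η) ^ s + ω * W ≤ (c + ε) * r ^ s := by
        have h1 : (r + η) ^ s ≤ (1 + η / δ) ^ s * r ^ s := by
          rw [← Real.mul_rpow (by positivity) hr.le]
          refine Real.rpow_le_rpow (by positivity) ?_ hs.le
          have : η ≤ η / δ * r := by
            rw [div_mul_eq_mul_div, le_div_iff₀ hδ0]; gcongr
          linarith
        have h2 : δ ^ s ≤ r ^ s := Real.rpow_le_rpow hδ0.le hrδ hs.le
        have h3 : 0 < r ^ s := Real.rpow_pos_of_pos hr _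
        calc c * (r + η) ^ s + ω * W ≤ c * ((1 + η / δ) ^ s * r ^ s) + ε / 2 * r ^ s := by
              refine add_le_add (by gcongr) (hω.trans (by gcongr))
          _ ≤ (c + ε / 2) * r ^ s + ε / 2 * r ^ s := by
              rw [← mul_assoc]; gcongr
          _ = _ := by ring
      calc ∫⁻ y in Metric.ball x r, φ y * h n y ∂μ
          = ∫⁻ y, (Metric.ball x r).indicator (fun y => (φ y : ℝ≥0∞)) y * h n y ∂μ := by
            rw [← lintegral_indicator Metric.isOpen_ball.measurableSet]
            congr 1; ext y
            by_cases hy : y ∈ Metric.ball x r <;> simp [hy]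
        _ ≤ ∫⁻ y, ((Metric.ball x (r + η)).indicator (fun y => (φ y : ℝ≥0∞)) y +
              K'.indicator (fun _ => (ω : ℝ≥0∞)) y) ∂μ := by
            refine lintegral_mul_le_of_average (hcont n) hνη hν1
              ((hφm.indicator Metric.isOpen_ball.measurableSet).add
                (measurable_const.indicator hK'm)) fun y t ht => ?_
            by_cases hy : y + t ∈ Metric.ball x r
            swap
            · simp [hy]
            by_cases h0 : φ (y + t) = 0
            · simp [hy, h0]
            have h1 : y ∈ Metric.ball x (r + η) := by
              have h2 := dist_triangle y (y + t) x
              have h3 : dist y (y + t) ≤ η := by simpa using ht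
              rw [Metric.mem_ball] at hy ⊢
              linarith
            simp only [hy, h1, hsub y t ht h0, Set.indicator_of_mem]
            exact_mod_cast (hcl y t ht).1
        _ = ∫⁻ y in Metric.ball x (r + η), φ y ∂μ + ω * W := by
            rw [lintegral_add_left (hφm.indicator Metric.isOpen_ball.measurableSet), hind,
              lintegral_indicator Metric.isOpen_ball.measurableSet]
        _ ≤ c * ENNReal.ofReal ((r + η) ^ s) + ω * W := by
            gcongr
            exact hc x _ (by positivity)
        _ = ENNReal.ofReal (c * (r + η) ^ s + ω * W) := by
            rw [ENNReal.ofReal_add (by positivity) (by positivity),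
              ENNReal.ofReal_mul (by positivity), ENNReal.ofReal_mul (by positivity)]
            simp
        _ ≤ ENNReal.ofReal ((c + ε) * r ^ s) := ENNReal.ofReal_le_ofReal hreal
        _ = (c + ε) * ENNReal.ofReal (r ^ s) := by
            rw [ENNReal.ofReal_mul (by positivity), ENNReal.ofReal_add (by positivity)
              (by positivity)]
            simp
  · calc ∫⁻ y, φ y ∂μ ≤ ∫⁻ y, ((φ y - K'.indicator (fun _ => (ω : ℝ≥0∞)) y) +
          K'.indicator (fun _ => (ω : ℝ≥0∞)) y) ∂μ := lintegral_mono fun y => le_tsub_add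
      _ = ∫⁻ y, (φ y - K'.indicator (fun _ => (ω : ℝ≥0∞)) y) ∂μ + ω * W := by
          rw [lintegral_add_right _ (measurable_const.indicator hK'm), hind]
      _ ≤ ∫⁻ y, φ y * h n y ∂μ + ε := by
          refine add_le_add ?_ ?_
          · refine le_lintegral_mul_of_average (F := fun y => (φ y : ℝ≥0∞)) (hcont n) hνη hν1
              (hφm.sub (measurable_const.indicator hK'm)) fun y t ht => ?_
            by_cases h0 : φ y = 0
            · simp [h0]
            have h1 : y ∈ K' := hsub y 0 (by simpa using hη0.le) (by simpa using h0)
            simp only [h1, Set.indicator_of_mem]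
            rw [tsub_le_iff_right]
            exact_mod_cast (hcl y t ht).2
          · exact_mod_cast hωε

theorem exists_continuous_lintegral_ball_le {E : Type*} [NormedAddCommGroup E] [NormedSpace ℝ E]
    [FiniteDimensional ℝ E] [MeasurableSpace E] [BorelSpace E] (μ : Measure E)
    [μ.IsAddHaarMeasure] {s : ℝ} (hs : 0 ≤ s) (hsd : s ≤ Module.finrank ℝ E) :
    ∃ φ : E → ℝ≥0, Continuous φ ∧ HasCompactSupport φ ∧ ∫⁻ y, φ y ∂μ ≠ 0 ∧
      ∃ c : ℝ≥0, ∫⁻ y, φ y ∂μ ≤ c ∧ ∀ x r, 0 < r →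
        ∫⁻ y in Metric.ball x r, φ y ∂μ ≤ c * ENNReal.ofReal (r ^ s) := by
  have : ProperSpace E := FiniteDimensional.proper ℝ E
  have hcont : Continuous fun x : E => (1 - ‖x‖).toNNReal := by fun_prop
  have hle : ∀ x : E, ((1 - ‖x‖).toNNReal : ℝ≥0∞) ≤
      (Metric.closedBall (0 : E) 1).indicator 1 x := fun x => by
    by_cases hx : x ∈ Metric.closedBall (0 : E) 1
    · simp [hx]
    · have : 1 ≤ ‖x‖ := by simpa using (not_le.1 (by simpa using hx)).le
      simp [hx, this]
  have hcb : MeasurableSet (Metric.closedBall (0 : E) 1) := Metric.isClosed_closedBall.measurableSet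
  have hfin : μ (Metric.closedBall (0 : E) 1) ≠ ∞ := measure_closedBall_lt_top.ne
  refine ⟨_, hcont, ?_, ?_, (μ (Metric.closedBall 0 1)).toNNReal, ?_, fun x r hr => ?_⟩
  · refine HasCompactSupport.intro (isCompact_closedBall (0 : E) 1) fun x hx => ?_
    have : 1 ≤ ‖x‖ := by simpa using (not_le.1 (by simpa using hx)).le
    simp [this]
  · rw [Ne, lintegral_eq_zero_iff hcont.measurable.coe_nnreal_ennreal]
    intro h0
    have := (Continuous.ae_eq_iff_eq μ (ENNReal.continuous_coe.comp hcont) continuous_const).1 h0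
    simpa using congrFun this 0
  · refine (lintegral_mono hle).trans ?_
    rw [lintegral_indicator_one hcb, ENNReal.coe_toNNReal hfin]
  · rw [ENNReal.coe_toNNReal hfin]
    rcases le_total r 1 with h1 | h1
    · calc ∫⁻ y in Metric.ball x r, (1 - ‖y‖).toNNReal ∂μ ≤ ∫⁻ y in Metric.ball x r, 1 ∂μ := by
            refine lintegral_mono fun y => (hle y).trans ?_
            exact Set.indicator_le_self' (fun _ _ => zero_le) y
        _ = ENNReal.ofReal (r ^ Module.finrank ℝ E) * μ (Metric.ball 0 1) := by
            rw [setLIntegral_one, Measure.addHaar_ball_of_pos μ x hr]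
        _ ≤ μ (Metric.closedBall 0 1) * ENNReal.ofReal (r ^ s) := by
            rw [mul_comm]
            gcongr
            · exact Metric.ball_subset_closedBall
            · rw [← Real.rpow_natCast]
              exact Real.rpow_le_rpow_of_exponent_ge hr h1 hsd
    · calc ∫⁻ y in Metric.ball x r, (1 - ‖y‖).toNNReal ∂μ ≤ ∫⁻ y, (1 - ‖y‖).toNNReal ∂μ :=
            setLIntegral_le_lintegral _ _
        _ ≤ μ (Metric.closedBall 0 1) * 1 := by
            refine (lintegral_mono hle).trans ?_
            rw [lintegral_indicator_one hcb, mul_one]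
        _ ≤ _ := by
            gcongr
            rw [ENNReal.one_le_ofReal]
            exact Real.one_le_rpow h1 hs

theorem le_dimH_setOf_forall_frequently_mem {E : Type*} [NormedAddCommGroup E] [NormedSpace ℝ E]
    [FiniteDimensional ℝ E] [MeasurableSpace E] [BorelSpace E] (μ : Measure E)
    [μ.IsAddHaarMeasure] {s s' : ℝ} (hs : 0 < s) (hss' : s < s')
    (hsd : s ≤ Module.finrank ℝ E) {V : ℕ → ℕ → Set E} {h : ℕ → ℕ → E → ℝ≥0}
    (hcont : ∀ i n, Continuous (h i n)) (hV : ∀ i n, tsupport (h i n) ⊆ V i n)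
    (hC : ∀ i, ∃ C : ℝ≥0, ∀ᶠ n in atTop, ∀ x r, 0 < r → r ≤ 1 →
      ∫⁻ y in Metric.ball x r, h i n y ∂μ ≤ C * ENNReal.ofReal (r ^ s'))
    (hav : ∀ i, ∀ η > 0, ∀ᶠ n in atTop, ∃ ν : Measure E, IsProbabilityMeasure ν ∧
      (∀ᵐ t ∂ν, ‖t‖ ≤ η) ∧ ∀ x, ∫⁻ t, h i n (x + t) ∂ν = 1) :
    ENNReal.ofReal s ≤ dimH {x | ∀ i, ∃ᶠ n in atTop, x ∈ V i n} := by
  obtain ⟨φ₀, hφ₀, hφ₀c, hM0, c₀, hMc, hc₀⟩ :=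
    exists_continuous_lintegral_ball_le μ hs.le hsd
  set M := ∫⁻ y, φ₀ y ∂μ with hM
  have hMt : M ≠ ∞ := ne_top_of_le_ne_top ENNReal.coe_ne_top hMc
  obtain ⟨ε, hε, hεM⟩ := ENNReal.exists_pos_sum_of_countable
    (ENNReal.div_pos hM0 ENNReal.ofNat_ne_top : 0 < M / 2).ne' ℕ
  let e : ℕ → ℝ≥0 := fun k => ∑ j ∈ Finset.range k, ε j
  have he : ∀ k, (e k : ℝ≥0∞) ≤ M / 2 := fun k => by
    refine le_trans ?_ hεM.le
    simp only [e, ENNReal.ofNNReal_finsetSum]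
    exact ENNReal.sum_le_tsum _
  let P : ℕ → (E → ℝ≥0) → Prop := fun k φ => Continuous φ ∧ HasCompactSupport φ ∧
    (∀ x r, 0 < r → ∫⁻ y in Metric.ball x r, φ y ∂μ ≤ (c₀ + e k : ℝ≥0) * ENNReal.ofReal (r ^ s)) ∧
    M ≤ ∫⁻ y, φ y ∂μ + e k
  have step : ∀ k φ, P k φ → ∃ φ', P (k + 1) φ' ∧ tsupport φ' ⊆ tsupport φ ∧
      ∃ n ≥ k, tsupport φ' ⊆ V (Nat.unpair k).1 n := by
    rintro k φ ⟨hφ, hφc, hball, hmass⟩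
    obtain ⟨C, hC⟩ := hC (Nat.unpair k).1
    obtain ⟨n, ⟨hn1, hn2⟩, hnk⟩ := ((eventually_ball_le_of_average hφ hφc hs hss'
      (hcont (Nat.unpair k).1) hC (hav _) hball (hε k)).and (eventually_ge_atTop k)).exists
    refine ⟨fun y => φ y * h (Nat.unpair k).1 n y, ⟨hφ.mul (hcont _ _), hφc.mul_right,
      fun x r hr => ?_, ?_⟩, closure_mono (Function.support_mul_subset_left _ _), n, hnk,
      (closure_mono (Function.support_mul_subset_right _ _)).trans (hV _ _)⟩
    · simp only [ENNReal.coe_mul]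
      refine (hn1 x r hr).trans (le_of_eq ?_)
      simp only [e, Finset.sum_range_succ]
      push_cast
      ring
    · refine hmass.trans ?_
      simp only [ENNReal.coe_mul]
      refine (add_le_add_left hn2 _).trans (le_of_eq ?_)
      simp only [e, Finset.sum_range_succ]
      push_cast
      ring
  choose! g hgP hgsub N hN hgV using step
  have hP0 : P 0 φ₀ := ⟨hφ₀, hφ₀c, by simpa [e] using hc₀, by simp [e, hM]⟩
  let Φ : ℕ → E → ℝ≥0 := fun k => Nat.rec φ₀ (fun k φ => g k φ) k
  have hΦ : ∀ k, P k (Φ k) := fun k => by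
    induction k with
    | zero => exact hP0
    | succ k ih => exact hgP k _ ih
  have hdim : ENNReal.ofReal s ≤ dimH (⋂ k, tsupport (Φ k)) := by
    refine le_dimH_of_frostman hs (fun k => (hΦ k).2.1)
      (antitone_nat_of_succ_le fun k => hgsub k _ (hΦ k))
      (fun k => μ.withDensity fun y => ENNReal.ofNNReal (Φ k y)) (C := c₀ + M / 2) (m := M / 2) ?_
      (ENNReal.div_pos hM0 ENNReal.ofNat_ne_top) (fun k => ?_) (fun k x r hr => ?_)
    · exact ENNReal.add_ne_top.2 ⟨ENNReal.coe_ne_top, ENNReal.div_ne_top hMt two_ne_zero⟩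
    · rw [withDensity_apply _ (isClosed_tsupport _).measurableSet,
        setLIntegral_eq_of_support_subset fun y hy =>
          subset_tsupport _ (by simpa using hy)]
      have h1 := (hΦ k).2.2.2.trans (add_le_add_right (he k) _)
      rw [← ENNReal.sub_half hMt]
      exact tsub_le_iff_right.2 h1
    · rw [withDensity_apply _ Metric.isOpen_ball.measurableSet]
      refine ((hΦ k).2.2.1 x r hr).trans ?_
      gcongr
      push_cast
      gcongr
      exact he k
  refine hdim.trans (dimH_mono fun x hx i => ?_)
  rw [Set.mem_iInter] at hx
  rw [frequently_atTop]
  intro a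
  have h1 := hgV (Nat.pair i a) _ (hΦ _) (hx (Nat.pair i a + 1))
  rw [Nat.unpair_pair] at h1
  exact ⟨_, (Nat.right_le_pair i a).trans (hN _ _ (hΦ _)), h1⟩

theorem exists_continuous_torus_bump {ρ : ℝ} (hρ : 0 < ρ) (hρ1 : ρ ≤ 1) :
    ∃ ψ : (Fin 2 → UnitAddCircle) → ℝ≥0, Continuous ψ ∧ ∫⁻ t, ψ t = 1 ∧
      (∀ t, (ψ t : ℝ≥0∞) ≤ ENNReal.ofReal (2 / ρ ^ 2)) ∧ ∀ t, ρ ≤ ‖t‖ → ψ t = 0 := by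
  let g : (Fin 2 → UnitAddCircle) → ℝ≥0 := fun t => (1 - ‖t‖ / ρ).toNNReal
  have hg : Continuous g := by fun_prop
  have hg1 : ∀ t, g t ≤ 1 := fun t => by
    simp only [g, Real.toNNReal_le_one]
    have : 0 ≤ ‖t‖ / ρ := by positivity
    linarith
  set I := ∫⁻ t, (g t : ℝ≥0∞) with hI
  have hI1 : I ≤ 1 := by
    calc I ≤ ∫⁻ _t : Fin 2 → UnitAddCircle, 1 :=
          lintegral_mono fun t => ENNReal.coe_le_one_iff.2 (hg1 t)
      _ = 1 := by simp [volume_pi, Measure.pi_univ]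
  have hI0 : ENNReal.ofReal (ρ ^ 2 / 2) ≤ I := by
    have hvol : volume (Metric.closedBall (0 : Fin 2 → UnitAddCircle) (ρ / 2)) =
        ENNReal.ofReal (ρ ^ 2) := by
      rw [closedBall_pi _ (by positivity), volume_pi, Measure.pi_pi]
      simp only [Fin.prod_univ_two, Pi.zero_apply, AddCircle.volume_closedBall]
      rw [mul_div_cancel₀ _ two_ne_zero, min_eq_right hρ1, ← ENNReal.ofReal_mul hρ.le, sq]
    calc ENNReal.ofReal (ρ ^ 2 / 2) =
        ENNReal.ofReal (1 / 2) * volume (Metric.closedBall (0 : Fin 2 → UnitAddCircle) (ρ / 2)) := by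
          rw [hvol, ← ENNReal.ofReal_mul (by positivity)]; congr 1; ring
      _ = ∫⁻ _t in Metric.closedBall (0 : Fin 2 → UnitAddCircle) (ρ / 2),
            ENNReal.ofReal (1 / 2) := by rw [setLIntegral_const]
      _ ≤ ∫⁻ t in Metric.closedBall (0 : Fin 2 → UnitAddCircle) (ρ / 2), g t := by
          refine setLIntegral_mono hg.measurable.coe_nnreal_ennreal fun t ht => ?_
          refine ENNReal.ofReal_le_ofReal ?_
          have h1 : ‖t‖ ≤ ρ / 2 := by simpa using ht
          have h2 : ‖t‖ / ρ ≤ 1 / 2 := by rw [div_le_iff₀ hρ]; linarith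
          linarith
      _ ≤ I := setLIntegral_le_lintegral _ _
  have hIt : I ≠ ∞ := ne_top_of_le_ne_top ENNReal.one_ne_top hI1
  have hIp : I ≠ 0 := (lt_of_lt_of_le (by simpa using pow_pos hρ 2) hI0).ne'
  have hKc : ((I⁻¹).toNNReal : ℝ≥0∞) = I⁻¹ := ENNReal.coe_toNNReal (ENNReal.inv_ne_top.2 hIp)
  refine ⟨fun t => (I⁻¹).toNNReal * g t, by fun_prop, ?_, fun t => ?_, fun t ht => ?_⟩
  · simp only [ENNReal.coe_mul, hKc]
    rw [lintegral_const_mul _ hg.measurable.coe_nnreal_ennreal, ENNReal.inv_mul_cancel hIp hIt]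
  · simp only [ENNReal.coe_mul, hKc]
    calc I⁻¹ * g t ≤ (ENNReal.ofReal (ρ ^ 2 / 2))⁻¹ * 1 := by
          gcongr
          exact_mod_cast hg1 t
      _ = _ := by rw [mul_one, ← ENNReal.ofReal_inv_of_pos (by positivity), inv_div]
  · have : 1 ≤ ‖t‖ / ρ := by rwa [one_le_div hρ]
    simp [g, this]

/-- The endomorphism of the two-torus induced by an integer matrix. -/
def toralEnd (B : Matrix (Fin 2) (Fin 2) ℤ) :
    (Fin 2 → UnitAddCircle) →+ (Fin 2 → UnitAddCircle) where
  toFun t i := ∑ j, B i j • t j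
  map_zero' := by ext; simp
  map_add' s t := by ext; simp [Finset.sum_add_distrib, smul_add]

theorem toralEnd_coe (B : Matrix (Fin 2) (Fin 2) ℤ) (s : Fin 2 → ℝ) :
    toralEnd B (fun i => (s i : UnitAddCircle)) =
      fun i => ((∑ j, (B i j : ℝ) * s j : ℝ) : UnitAddCircle) := by
  ext i
  simp [toralEnd]

theorem measurePreserving_toralEnd {B : Matrix (Fin 2) (Fin 2) ℤ} (hB : B.det ≠ 0) :
    MeasurePreserving (toralEnd B) volume volume := by
  have hB' : (B.map (Int.cast : ℤ → ℝ)).det ≠ 0 := by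
    have := Int.cast_det (R := ℝ) B
    rw [← this]; exact_mod_cast hB
  refine AddMonoidHom.measurePreserving ?_ ?_ rfl
  · refine continuous_pi fun i => ?_
    change Continuous fun t : Fin 2 → UnitAddCircle => ∑ j, B i j • t j
    fun_prop
  · intro t
    choose s hs using fun i => QuotientAddGroup.mk_surjective (t i)
    refine ⟨fun i => ((((B.map (Int.cast : ℤ → ℝ))⁻¹.mulVec s) i : ℝ) : UnitAddCircle), ?_⟩
    rw [toralEnd_coe]
    ext i
    have h1 : (B.map (Int.cast : ℤ → ℝ)).mulVec ((B.map (Int.cast : ℤ → ℝ))⁻¹.mulVec s) = s := by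
      rw [Matrix.mulVec_mulVec, Matrix.mul_nonsing_inv _ (isUnit_iff_ne_zero.2 hB'),
        Matrix.one_mulVec]
    rw [← hs i]
    exact congrArg _ (congrFun h1 i)

theorem lintegral_add_toralEnd_coe {B : Matrix (Fin 2) (Fin 2) ℤ} (hB : B.det ≠ 0)
    {ψ : (Fin 2 → UnitAddCircle) → ℝ≥0} (hψ : Continuous ψ) (t₀ : Fin 2 → UnitAddCircle) :
    ∫⁻ s, ψ (t₀ + toralEnd B fun i => (s i : UnitAddCircle))
      ∂Measure.pi (fun _ : Fin 2 => volume.restrict (Set.Ioc (0 : ℝ) 1)) = ∫⁻ t, ψ t := by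
  have h1 : MeasurePreserving (fun (s : Fin 2 → ℝ) i => (s i : UnitAddCircle))
      (Measure.pi (fun _ : Fin 2 => volume.restrict (Set.Ioc (0 : ℝ) 1))) volume := by
    refine measurePreserving_pi _ _ fun _ => ?_
    simpa using UnitAddCircle.measurePreserving_mk 0
  have h2 := ((measurePreserving_add_left volume t₀).comp (measurePreserving_toralEnd hB)).comp h1
  exact h2.lintegral_comp hψ.measurable.coe_nnreal_ennreal

theorem exists_finset_card_le_of_one_le_mul {ι : Type*} {p : ι → ℝ × ℝ}
    (hp : ∀ z w, z ≠ w → 1 ≤ |(p z).1 - (p w).1| * |(p z).2 - (p w).2|) (X : ℝ × ℝ) {a b : ℝ}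
    (ha : 0 ≤ a) (hb : 0 ≤ b) :
    ∃ S : Finset ι, (∀ z, |(p z).1 - X.1| ≤ a → |(p z).2 - X.2| ≤ b → z ∈ S) ∧
      (S.card : ℝ) ≤ 4 * (a * b) + 2 := by
  let T : Set ι := {z | |(p z).1 - X.1| ≤ a ∧ |(p z).2 - X.2| ≤ b}
  let F : ι → ℤ := fun z => ⌊(p z).1 * (2 * b)⌋
  let J := Finset.Icc ⌊(X.1 - a) * (2 * b)⌋ ⌊(X.1 + a) * (2 * b)⌋
  have hmaps : ∀ z ∈ T, F z ∈ J := fun z hz => by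
    have := abs_le.1 hz.1
    refine Finset.mem_Icc.2 ⟨Int.floor_le_floor ?_, Int.floor_le_floor ?_⟩ <;> gcongr <;> linarith
  have hinj : Set.InjOn F T := fun z hz w hw hzw => by
    by_contra hne
    have h1 := hp z w hne
    have h2 := Int.abs_sub_lt_one_of_floor_eq_floor hzw
    rw [← sub_mul, abs_mul, abs_of_nonneg (by positivity : 0 ≤ 2 * b)] at h2
    have h3 : |(p z).2 - (p w).2| ≤ 2 * b := by
      have h4 := abs_le.1 hz.2
      have h5 := abs_le.1 hw.2
      rw [abs_le]; constructor <;> linarith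
    have h4 : |(p z).1 - (p w).1| * |(p z).2 - (p w).2| ≤ |(p z).1 - (p w).1| * (2 * b) := by
      gcongr
    linarith
  have hfin : T.Finite := Set.Finite.of_injOn (t := (J : Set ℤ)) hmaps hinj J.finite_toSet
  refine ⟨hfin.toFinset, fun z h1 h2 => hfin.mem_toFinset.2 ⟨h1, h2⟩, ?_⟩
  have hcard : hfin.toFinset.card ≤ J.card :=
    Finset.card_le_card_of_injOn F (fun z hz => hmaps z (hfin.mem_toFinset.1 hz))
      (by simpa using hinj)
  have hJ : (J.card : ℝ) ≤ 4 * (a * b) + 2 := by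
    have hle : ⌊(X.1 - a) * (2 * b)⌋ ≤ ⌊(X.1 + a) * (2 * b)⌋ + 1 := by
      have : ⌊(X.1 - a) * (2 * b)⌋ ≤ ⌊(X.1 + a) * (2 * b)⌋ := by
        apply Int.floor_le_floor; gcongr; linarith
      omega
    have h1 : ((J.card : ℤ) : ℝ) = ⌊(X.1 + a) * (2 * b)⌋ + 1 - ⌊(X.1 - a) * (2 * b)⌋ := by
      rw [Int.card_Icc_of_le _ _ hle]; push_cast; ring
    have h2 := Int.floor_le ((X.1 + a) * (2 * b))
    have h3 := Int.lt_floor_add_one ((X.1 - a) * (2 * b))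
    rw [Int.cast_natCast] at h1
    rw [h1]
    linarith
  exact le_trans (by exact_mod_cast hcard) hJ

section Rectangles
variable {E : Type*} [NormedAddCommGroup E] [NormedSpace ℝ E]
  [MeasurableSpace E] [BorelSpace E] (μ : Measure E) [μ.IsAddHaarMeasure]

theorem exists_measure_rectangle_le (Ψ : E ≃L[ℝ] ℝ × ℝ) :
    ∃ D : ℝ≥0, ∀ (X : ℝ × ℝ) (a b : ℝ), 0 ≤ a → 0 ≤ b →
      μ {y | |(Ψ y).1 - X.1| ≤ a ∧ |(Ψ y).2 - X.2| ≤ b} ≤ D * ENNReal.ofReal (a * b) := by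
  have hH : (μ.map Ψ).IsAddHaarMeasure := Ψ.isAddHaarMeasure_map μ
  have h1 := Measure.isAddLeftInvariant_eq_smul (μ.map Ψ) volume
  set c := Measure.addHaarScalarFactor (μ.map Ψ) volume
  refine ⟨c * 4, fun X a b ha hb => ?_⟩
  have h2 : {y | |(Ψ y).1 - X.1| ≤ a ∧ |(Ψ y).2 - X.2| ≤ b} =
      Ψ ⁻¹' (Metric.closedBall X.1 a ×ˢ Metric.closedBall X.2 b) := by
    ext y; simp [Real.dist_eq]
  rw [h2, ← Measure.map_apply Ψ.continuous.measurable
    (Metric.isClosed_closedBall.measurableSet.prod Metric.isClosed_closedBall.measurableSet), h1,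
    Measure.smul_apply, Measure.volume_eq_prod, Measure.prod_prod, Real.volume_closedBall,
    Real.volume_closedBall, ← ENNReal.ofReal_mul (by positivity), ENNReal.smul_def, smul_eq_mul,
    ENNReal.coe_mul, show 2 * a * (2 * b) = 4 * (a * b) by ring,
    ENNReal.ofReal_mul (by norm_num)]
  simp [mul_assoc]

theorem exists_measure_ball_inter_preimage_le (Ψ : E ≃L[ℝ] ℝ × ℝ) {ι : Type*} {p : ι → ℝ × ℝ}
    (hp : ∀ z w, z ≠ w → 1 ≤ |(p z).1 - (p w).1| * |(p z).2 - (p w).2|) :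
    ∃ D : ℝ≥0, ∃ κ : ℝ, 0 < κ ∧ ∀ (q : ℝ × ℝ) (α β ρ r : ℝ) (x : E), α ≠ 0 → β ≠ 0 → 0 < ρ →
      0 < r →
      μ {y | y ∈ Metric.ball x r ∧ ∃ z, |α * (Ψ y).1 + q.1 - (p z).1| ≤ ρ ∧
        |β * (Ψ y).2 + q.2 - (p z).2| ≤ ρ} ≤
      D * ENNReal.ofReal (ρ ^ 2 * (κ * r) ^ 2 +
        min (κ * r) (ρ / |α|) * min (κ * r) (ρ / |β|)) := by
  obtain ⟨D, hD⟩ := exists_measure_rectangle_le μ Ψ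
  obtain ⟨κ, hκ, hκΨ⟩ := Ψ.toContinuousLinearMap.bound
  refine ⟨D * 16, κ, hκ, fun q α β ρ r x hα hβ hρ hr => ?_⟩
  set R := κ * r with hR
  have hR0 : 0 < R := by positivity
  have hα' : 0 < |α| := abs_pos.2 hα
  have hβ' : 0 < |β| := abs_pos.2 hβ
  have hdist : ∀ y ∈ Metric.ball x r, |(Ψ y).1 - (Ψ x).1| ≤ R ∧ |(Ψ y).2 - (Ψ x).2| ≤ R := by
    intro y hy
    have h1 : ‖Ψ y - Ψ x‖ ≤ R := by
      rw [← map_sub]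
      refine (hκΨ (y - x)).trans ?_
      rw [hR, ← dist_eq_norm]
      gcongr
      exact (Metric.mem_ball.1 hy).le
    exact ⟨(norm_fst_le _).trans h1, (norm_snd_le _).trans h1⟩
  have hscale : ∀ γ u v w : ℝ, γ ≠ 0 → |γ * u + v - w| ≤ ρ → |u - (w - v) / γ| ≤ ρ / |γ| := by
    intro γ u v w hγ h
    rw [le_div_iff₀ (abs_pos.2 hγ), ← abs_mul]
    rwa [sub_mul, div_mul_cancel₀ _ hγ, show u * γ - (w - v) = γ * u + v - w by ring]
  obtain ⟨S, hS, hcard⟩ := exists_finset_card_le_of_one_le_mul hp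
    (α * (Ψ x).1 + q.1, β * (Ψ x).2 + q.2) (a := |α| * R + ρ) (b := |β| * R + ρ)
    (by positivity) (by positivity)
  set m₁ := min R (ρ / |α|) with hm₁
  set m₂ := min R (ρ / |β|) with hm₂
  have hm₁0 : 0 ≤ m₁ := by positivity
  have hm₂0 : 0 ≤ m₂ := by positivity
  have hpiece : ∀ z, μ {y | y ∈ Metric.ball x r ∧ |α * (Ψ y).1 + q.1 - (p z).1| ≤ ρ ∧
        |β * (Ψ y).2 + q.2 - (p z).2| ≤ ρ} ≤ D * ENNReal.ofReal (m₁ * m₂) := by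
    intro z
    have hex : ∀ (c d e f : ℝ), ∃ X, ∀ u : ℝ, |u - c| ≤ e → |u - d| ≤ f → |u - X| ≤ min e f := by
      intro c d e f
      rcases le_total e f with h | h
      · exact ⟨c, fun u h1 _ => by rwa [min_eq_left h]⟩
      · exact ⟨d, fun u _ h2 => by rwa [min_eq_right h]⟩
    obtain ⟨X₁, hX₁⟩ := hex (Ψ x).1 (((p z).1 - q.1) / α) R (ρ / |α|)
    obtain ⟨X₂, hX₂⟩ := hex (Ψ x).2 (((p z).2 - q.2) / β) R (ρ / |β|)
    refine (measure_mono ?_).trans (hD (X₁, X₂) m₁ m₂ hm₁0 hm₂0)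
    rintro y ⟨hy, h1, h2⟩
    exact ⟨hX₁ _ (hdist y hy).1 (hscale _ _ _ _ hα h1),
      hX₂ _ (hdist y hy).2 (hscale _ _ _ _ hβ h2)⟩
  have hcover : {y | y ∈ Metric.ball x r ∧ ∃ z, |α * (Ψ y).1 + q.1 - (p z).1| ≤ ρ ∧
        |β * (Ψ y).2 + q.2 - (p z).2| ≤ ρ} ⊆ ⋃ z ∈ S, {y | y ∈ Metric.ball x r ∧
          |α * (Ψ y).1 + q.1 - (p z).1| ≤ ρ ∧ |β * (Ψ y).2 + q.2 - (p z).2| ≤ ρ} := by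
    rintro y ⟨hy, z, h1, h2⟩
    have hnear : ∀ γ u u' v w : ℝ, |γ * u + v - w| ≤ ρ → |u - u'| ≤ R →
        |w - (γ * u' + v)| ≤ |γ| * R + ρ := by
      intro γ u u' v w h3 h4
      have h5 : w - (γ * u' + v) = γ * (u - u') - (γ * u + v - w) := by ring
      rw [h5]
      refine (abs_sub _ _).trans ?_
      rw [abs_mul]
      gcongr
    exact Set.mem_biUnion (hS z (hnear _ _ _ _ _ h1 (hdist y hy).1)
      (hnear _ _ _ _ _ h2 (hdist y hy).2)) ⟨hy, h1, h2⟩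
  have hprod : ∀ γ : ℝ, 0 < γ → min R (ρ / γ) * (γ * R + ρ) ≤ 2 * (ρ * R) := by
    intro γ hγ
    have h1 : min R (ρ / γ) * ρ ≤ R * ρ := by gcongr; exact min_le_left _ _
    have h2 : min R (ρ / γ) * (γ * R) ≤ ρ / γ * (γ * R) := by gcongr; exact min_le_right _ _
    have h3 : ρ / γ * (γ * R) = ρ * R := by field_simp
    linarith
  calc μ {y | y ∈ Metric.ball x r ∧ ∃ z, |α * (Ψ y).1 + q.1 - (p z).1| ≤ ρ ∧
        |β * (Ψ y).2 + q.2 - (p z).2| ≤ ρ}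
      ≤ ∑ z ∈ S, D * ENNReal.ofReal (m₁ * m₂) :=
        (measure_mono hcover).trans ((measure_biUnion_finset_le _ _).trans
          (Finset.sum_le_sum fun z _ => hpiece z))
    _ = D * ENNReal.ofReal (S.card * (m₁ * m₂)) := by
        rw [Finset.sum_const, nsmul_eq_mul, ENNReal.ofReal_mul (Nat.cast_nonneg S.card),
          ENNReal.ofReal_natCast]
        ring
    _ ≤ D * ENNReal.ofReal (16 * (ρ ^ 2 * R ^ 2 + m₁ * m₂)) := by
        refine mul_le_mul_right (ENNReal.ofReal_le_ofReal ?_) _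
        have h1 := mul_le_mul (hprod _ hα') (hprod _ hβ') (by positivity) (by positivity)
        have h2 : (S.card : ℝ) * (m₁ * m₂) ≤
            (4 * ((|α| * R + ρ) * (|β| * R + ρ)) + 2) * (m₁ * m₂) := by gcongr
        have h3 : 0 ≤ m₁ * m₂ := by positivity
        calc _ ≤ _ := h2
          _ = 4 * (m₁ * (|α| * R + ρ) * (m₂ * (|β| * R + ρ))) + 2 * (m₁ * m₂) := by ring
          _ ≤ 4 * (2 * (ρ * R) * (2 * (ρ * R))) + 2 * (m₁ * m₂) := by gcongr
          _ ≤ 16 * (ρ ^ 2 * R ^ 2 + m₁ * m₂) := by nlinarith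
    _ = (D * 16 : ℝ≥0) * ENNReal.ofReal (ρ ^ 2 * R ^ 2 + m₁ * m₂) := by
        rw [ENNReal.ofReal_mul (by norm_num), ENNReal.coe_mul, mul_assoc]
        simp

end Rectangles

theorem min_le_rpow_mul_rpow {a b θ : ℝ} (ha : 0 < a) (hb : 0 < b) (h0 : 0 ≤ θ) (h1 : θ ≤ 1) :
    min a b ≤ a ^ θ * b ^ (1 - θ) := by
  have hm : 0 < min a b := lt_min ha hb
  calc min a b = min a b ^ θ * min a b ^ (1 - θ) := by
        rw [← Real.rpow_add hm]; simp
    _ ≤ a ^ θ * b ^ (1 - θ) := by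
        have := sub_nonneg.2 h1
        gcongr
        · exact min_le_left _ _
        · exact min_le_right _ _

theorem min_mul_min_le_rpow {τ L : ℝ} (hτ : 0 < τ) (hL : 0 < L) {r : ℝ} (hr : 0 < r) (n : ℕ) :
    min r (Real.exp (-n * τ) / Real.exp (n * L)) * min r (Real.exp (-n * τ)) ≤
      r ^ min (2 * L / (τ + L)) (L / τ) * Real.exp (-n * τ) ^ 2 := by
  set s := min (2 * L / (τ + L)) (L / τ) with hs
  have hs0 : 0 < s := by positivity
  have hs1 : s * (τ + L) ≤ 2 * L := by
    rw [← le_div_iff₀ (by positivity)]; exact min_le_left _ _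
  have hs2 : s * τ ≤ L := by
    rw [← le_div_iff₀ (by positivity)]; exact min_le_right _ _
  have hexp : ∀ x y : ℝ, Real.exp x ^ y = Real.exp (x * y) := fun x y => (Real.exp_mul x y).symm
  rcases le_total s 1 with h1 | h1
  · calc min r (Real.exp (-n * τ) / Real.exp (n * L)) * min r (Real.exp (-n * τ))
        ≤ (Real.exp (-n * τ) / Real.exp (n * L)) * (r ^ s * Real.exp (-n * τ) ^ (1 - s)) := by
          gcongr
          · exact min_le_right _ _
          · exact min_le_rpow_mul_rpow hr (Real.exp_pos _) hs0.le h1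
      _ = r ^ s * Real.exp (-n * τ - n * L + -n * τ * (1 - s)) := by
          rw [hexp, ← Real.exp_sub, Real.exp_add]; ring
      _ ≤ r ^ s * Real.exp (-n * τ) ^ 2 := by
          rw [← Real.exp_nat_mul]
          refine mul_le_mul_of_nonneg_left (Real.exp_le_exp.2 ?_) (by positivity)
          push_cast
          nlinarith [(Nat.cast_nonneg n : (0 : ℝ) ≤ n)]
  · have h2 : s - 1 ≤ 1 := by
      by_contra h
      nlinarith
    calc min r (Real.exp (-n * τ) / Real.exp (n * L)) * min r (Real.exp (-n * τ))
        ≤ (r ^ (s - 1) * (Real.exp (-n * τ) / Real.exp (n * L)) ^ (1 - (s - 1))) * r := by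
          gcongr
          · exact min_le_rpow_mul_rpow hr (by positivity) (by linarith) h2
          · exact min_le_left _ _
      _ = r ^ s * Real.exp ((-n * τ - n * L) * (1 - (s - 1))) := by
          rw [← Real.exp_sub, hexp, Real.rpow_sub_one hr.ne']
          field_simp
      _ ≤ r ^ s * Real.exp (-n * τ) ^ 2 := by
          rw [← Real.exp_nat_mul]
          refine mul_le_mul_of_nonneg_left (Real.exp_le_exp.2 ?_) (by positivity)
          push_cast
          nlinarith [(Nat.cast_nonneg n : (0 : ℝ) ≤ n)]

theorem irrational_of_quadratic {l : ℝ} (t d : ℤ) (hl : l ^ 2 - t * l + d = 0) (h0 : 0 < |l|)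
    (h1 : |l| < 1) : Irrational l := by
  rintro ⟨q, rfl⟩
  have hint : IsIntegral ℤ q := by
    refine ⟨Polynomial.X ^ 2 - Polynomial.C t * Polynomial.X + Polynomial.C d, by monicity!, ?_⟩
    have : q ^ 2 - t * q + d = 0 := by exact_mod_cast hl
    simp only [Polynomial.eval₂_add, Polynomial.eval₂_sub, Polynomial.eval₂_mul,
      Polynomial.eval₂_X_pow, Polynomial.eval₂_C, Polynomial.eval₂_X]
    simpa using this
  obtain ⟨m, hm⟩ := IsIntegrallyClosed.isIntegral_iff.1 hint
  have hm' : (m : ℝ) = (q : ℝ) := by exact_mod_cast hm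
  rw [← hm'] at h0 h1
  have h2 : |m| < 1 := by exact_mod_cast h1
  have h3 : 0 < |m| := by exact_mod_cast h0
  omega

theorem Matrix.toEuclideanLin_map_intCast_apply (A : Matrix (Fin 2) (Fin 2) ℤ)
    (x : EuclideanSpace ℝ (Fin 2)) (i : Fin 2) :
    Matrix.toEuclideanLin (A.map (Int.cast : ℤ → ℝ)) x i = ∑ j, (A i j : ℝ) * x j := by
  rfl

theorem Matrix.toEuclideanLin_pow_succ_map_intCast (A : Matrix (Fin 2) (Fin 2) ℤ) (n : ℕ)
    (x : EuclideanSpace ℝ (Fin 2)) :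
    Matrix.toEuclideanLin ((A ^ (n + 1)).map (Int.cast : ℤ → ℝ)) x =
      Matrix.toEuclideanLin (A.map (Int.cast : ℤ → ℝ))
        (Matrix.toEuclideanLin ((A ^ n).map (Int.cast : ℤ → ℝ)) x) := by
  ext i
  rw [pow_succ']
  simp only [Matrix.toEuclideanLin_map_intCast_apply, Matrix.mul_apply, Fin.sum_univ_two]
  push_cast
  ring

@[simp]
theorem intVec_apply (z : Fin 2 → ℤ) (i : Fin 2) : intVec z i = z i := rfl

section Eigen
variable {A : Matrix (Fin 2) (Fin 2) ℤ} {l₁ l₂ : ℝ}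

theorem exists_eigen_coordinates (hsum : l₁ + l₂ = (A.trace : ℝ)) (hprod : l₁ * l₂ = (A.det : ℝ))
    (h0 : 0 < |l₁|) (h1 : |l₁| < 1) (h2 : 1 < |l₂|) :
    ∃ Φ : EuclideanSpace ℝ (Fin 2) ≃L[ℝ] ℝ × ℝ,
      (∀ (n : ℕ) x, Φ (Matrix.toEuclideanLin ((A ^ n).map (Int.cast : ℤ → ℝ)) x) =
        (l₂ ^ n * (Φ x).1, l₁ ^ n * (Φ x).2)) ∧
      ∀ z w : Fin 2 → ℤ, z ≠ w →
        1 ≤ |(Φ (intVec z)).1 - (Φ (intVec w)).1| * |(Φ (intVec z)).2 - (Φ (intVec w)).2| := by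
  rw [Matrix.trace_fin_two] at hsum
  rw [Matrix.det_fin_two] at hprod
  set a := A 0 0 with ha
  set b := A 0 1 with hb
  set c := A 1 0 with hc
  set d := A 1 1 with hd
  push_cast at hsum hprod
  have hirr₁ : Irrational l₁ := by
    refine irrational_of_quadratic (a + d) (a * d - b * c) ?_ h0 h1
    push_cast
    linear_combination l₁ * hsum - hprod
  have hirr₂ : Irrational l₂ := by
    have : l₂ = ((a + d : ℤ) : ℝ) - l₁ := by push_cast; linarith
    rw [this]
    exact hirr₁.intCast_sub _
  have hroot₁ : (l₁ - a) * (l₁ - d) = b * c := by linear_combination l₁ * hsum - hprod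
  have hroot₂ : (l₂ - a) * (l₂ - d) = b * c := by linear_combination l₂ * hsum - hprod
  have hc0 : (c : ℝ) ≠ 0 := by
    intro h
    rw [h, mul_zero, mul_eq_zero, sub_eq_zero, sub_eq_zero] at hroot₁
    rcases hroot₁ with h | h
    · exact hirr₁.ne_int _ h
    · exact hirr₁.ne_int _ h
  have hne : l₁ ≠ l₂ := by rintro rfl; linarith
  let P : EuclideanSpace ℝ (Fin 2) →ₗ[ℝ] ℝ × ℝ :=
    { toFun := fun x => (c * x 0 + (l₂ - a) * x 1, c * x 0 + (l₁ - a) * x 1)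
      map_add' := fun x y => by ext <;> simp <;> ring
      map_smul' := fun r x => by ext <;> simp <;> ring }
  have hP : Function.Injective P := by
    rw [← LinearMap.ker_eq_bot, LinearMap.ker_eq_bot']
    intro x hx
    have hx1 : c * x 0 + (l₂ - a) * x 1 = 0 := congrArg Prod.fst hx
    have hx2 : c * x 0 + (l₁ - a) * x 1 = 0 := congrArg Prod.snd hx
    have h3 : x 1 = 0 := by
      have : (l₂ - l₁) * x 1 = 0 := by linear_combination hx1 - hx2
      exact (mul_eq_zero.1 this).resolve_left (sub_ne_zero.2 hne.symm)
    have h4 : x 0 = 0 := by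
      rw [h3, mul_zero, add_zero] at hx1
      exact (mul_eq_zero.1 hx1).resolve_left hc0
    ext i
    fin_cases i
    · exact h4
    · exact h3
  let Φ := (LinearEquiv.ofInjectiveOfFinrankEq P hP (by simp)).toContinuousLinearEquiv
  have hΦ : ∀ x, Φ x = (c * x 0 + (l₂ - a) * x 1, c * x 0 + (l₁ - a) * x 1) := fun x => rfl
  refine ⟨Φ, fun n => ?_, fun z w hzw => ?_⟩
  · induction n with
    | zero =>
      intro x
      simp
    | succ n ih =>
      intro x
      have hstep : ∀ y, Φ (Matrix.toEuclideanLin (A.map (Int.cast : ℤ → ℝ)) y) =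
          (l₂ * (Φ y).1, l₁ * (Φ y).2) := by
        intro y
        simp only [hΦ, Matrix.toEuclideanLin_map_intCast_apply, Fin.sum_univ_two, ← ha, ← hb, ← hc,
          ← hd]
        ext
        · simp only
          linear_combination (-y 1) * hroot₂
        · simp only
          linear_combination (-y 1) * hroot₁
      rw [Matrix.toEuclideanLin_pow_succ_map_intCast, hstep, ih]
      ext
      · simp only; ring
      · simp only; ring
  · have hlin : ∀ l : ℝ, Irrational l →
        c * ((z 0 : ℝ) - w 0) + (l - a) * ((z 1 : ℝ) - w 1) ≠ 0 := by
      intro l hl h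
      have hz1 : z 1 = w 1 := by
        by_contra hne
        have hne' : ((z 1 - w 1 : ℤ) : ℝ) ≠ 0 := by exact_mod_cast sub_ne_zero.2 hne
        refine hl ⟨(a - c * (z 0 - w 0) / (z 1 - w 1 : ℤ) : ℚ), ?_⟩
        push_cast at hne' ⊢
        field_simp
        linear_combination -h
      rw [hz1, sub_self, mul_zero, add_zero, mul_eq_zero, sub_eq_zero] at h
      refine hzw (funext fun i => ?_)
      fin_cases i
      · exact_mod_cast h.resolve_left hc0
      · exact hz1
    let N : ℤ := c ^ 2 * (z 0 - w 0) ^ 2 + c * (z 0 - w 0) * (z 1 - w 1) * (d - a) -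
      b * c * (z 1 - w 1) ^ 2
    have hN : (N : ℝ) = (c * ((z 0 : ℝ) - w 0) + (l₂ - a) * ((z 1 : ℝ) - w 1)) *
        (c * ((z 0 : ℝ) - w 0) + (l₁ - a) * ((z 1 : ℝ) - w 1)) := by
      simp only [N]
      push_cast
      linear_combination (-c * ((z 0 : ℝ) - w 0) * ((z 1 : ℝ) - w 1) +
        a * ((z 1 : ℝ) - w 1) ^ 2) * hsum - ((z 1 : ℝ) - w 1) ^ 2 * hprod
    have hN0 : N ≠ 0 := by
      have : (N : ℝ) ≠ 0 := by rw [hN]; exact mul_ne_zero (hlin _ hirr₂) (hlin _ hirr₁)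
      exact_mod_cast this
    have hN1 : (1 : ℝ) ≤ |(N : ℝ)| := by exact_mod_cast Int.one_le_abs hN0
    rw [hN, abs_mul] at hN1
    simp only [hΦ, intVec_apply]
    have hsub : ∀ l : ℝ, c * (z 0 : ℝ) + (l - a) * z 1 - (c * w 0 + (l - a) * w 1) =
        c * ((z 0 : ℝ) - w 0) + (l - a) * ((z 1 : ℝ) - w 1) := fun l => by ring
    rwa [hsub, hsub]

end Eigen

theorem exists_rightInverse_of_dist_eq {E : Type*} [NormedAddCommGroup E] [InnerProductSpace ℝ E]
    [FiniteDimensional ℝ E] {f : E → E} {c : ℝ} (hc : 0 < c)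
    (hf : ∀ x y, dist (f x) (f y) = c * dist x y) :
    ∃ (T : E ≃L[ℝ] E) (b : E), ∀ y, f (T y + b) = y := by
  have hg : Isometry fun x => c⁻¹ • f x := Isometry.of_dist_eq fun x y => by
    rw [dist_smul₀, hf, Real.norm_of_nonneg (by positivity), inv_mul_cancel_left₀ hc.ne']
  let g := hg.affineIsometryOfStrictConvexSpace
  have hgf : ∀ x, f x = c • (g.linearIsometry x + g 0) := by
    intro x
    have h1 : g x = c⁻¹ • f x := rfl
    have h2 := g.map_vadd 0 x
    simp only [vadd_eq_add, add_zero] at h2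
    rw [← h2, h1, smul_inv_smul₀ hc.ne']
  let S := (g.linearIsometry.toLinearIsometryEquiv rfl).toContinuousLinearEquiv
  have hS : ∀ x, S x = g.linearIsometry x := fun x => rfl
  let T : E ≃L[ℝ] E := (ContinuousLinearEquiv.smulLeft (Units.mk0 c⁻¹ (inv_ne_zero hc.ne'))).trans
    S.symm
  refine ⟨T, S.symm (-g 0), fun y => ?_⟩
  have hT : T y = S.symm (c⁻¹ • y) := rfl
  rw [hgf, ← hS, map_add, hT, S.apply_symm_apply, S.apply_symm_apply]
  simp [hc.ne']

section Return
variable {A : Matrix (Fin 2) (Fin 2) ℤ}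

/-- The displacement `x ↦ Aⁿx - x` of the lift of the `n`-th iterate of a toral endomorphism. -/
noncomputable def displacement (A : Matrix (Fin 2) (Fin 2) ℤ) (n : ℕ) :
    EuclideanSpace ℝ (Fin 2) →ₗ[ℝ] EuclideanSpace ℝ (Fin 2) :=
  Matrix.toEuclideanLin ((A ^ n).map (Int.cast : ℤ → ℝ)) - LinearMap.id

theorem displacement_apply (n : ℕ) (x : EuclideanSpace ℝ (Fin 2)) :
    displacement A n x = Matrix.toEuclideanLin ((A ^ n).map (Int.cast : ℤ → ℝ)) x - x := rfl

@[fun_prop]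
theorem continuous_displacement (n : ℕ) : Continuous (displacement A n) :=
  LinearMap.continuous_of_finiteDimensional _

/-- The projection from the plane to the two-torus. -/
def torusProj (x : EuclideanSpace ℝ (Fin 2)) : Fin 2 → UnitAddCircle := fun i => (x i : ℝ)

@[fun_prop]
theorem continuous_torusProj : Continuous torusProj :=
  continuous_pi fun i => (AddCircle.continuous_mk' 1).comp (by fun_prop)

theorem torusProj_add (x y : EuclideanSpace ℝ (Fin 2)) :
    torusProj (x + y) = torusProj x + torusProj y := rfl

theorem exists_norm_sub_intVec_le (x : EuclideanSpace ℝ (Fin 2)) :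
    ∃ z, ‖x - intVec z‖ ≤ √2 * ‖torusProj x‖ := by
  refine ⟨fun i => round (x i), ?_⟩
  have h : ∀ i, |x i - round (x i)| ≤ ‖torusProj x‖ := fun i => by
    rw [← UnitAddCircle.norm_eq]
    exact norm_le_pi_norm (torusProj x) i
  rw [EuclideanSpace.norm_eq, ← Real.sqrt_sq (norm_nonneg (torusProj x)), ← Real.sqrt_mul (by simp)]
  refine Real.sqrt_le_sqrt ?_
  have h0 := pow_le_pow_left₀ (abs_nonneg _) (h 0) 2
  have h1 := pow_le_pow_left₀ (abs_nonneg _) (h 1) 2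
  simp only [Fin.sum_univ_two, PiLp.sub_apply, intVec_apply, Real.norm_eq_abs]
  linarith

theorem tsupport_comp_torusProj_subset {ψ : (Fin 2 → UnitAddCircle) → ℝ≥0} {e : ℝ} (he : 0 < e)
    (hψ : ∀ t, e / 2 ≤ ‖t‖ → ψ t = 0) {g : EuclideanSpace ℝ (Fin 2) → EuclideanSpace ℝ (Fin 2)}
    (hg : Continuous g) :
    tsupport (fun y => ψ (torusProj (g y))) ⊆ {y | ∃ z, ‖g y - intVec z‖ < e} := by
  have h1 : tsupport (fun y => ψ (torusProj (g y))) ⊆ {y | ‖torusProj (g y)‖ ≤ e / 2} := by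
    refine closure_minimal (fun y hy => ?_) (isClosed_le (by fun_prop) (by fun_prop))
    by_contra h
    exact hy (hψ _ (not_le.1 h).le)
  intro y hy
  obtain ⟨z, hz⟩ := exists_norm_sub_intVec_le (g y)
  refine ⟨z, hz.trans_lt ?_⟩
  have h2 : ‖torusProj (g y)‖ ≤ e / 2 := h1 hy
  have h3 : √2 < 2 := by rw [Real.sqrt_lt' (by norm_num)]; norm_num
  calc √2 * ‖torusProj (g y)‖ ≤ √2 * (e / 2) := by gcongr
    _ < 2 * (e / 2) := by gcongr
    _ = e := by ring

theorem min_mul_mul_le {κ K r u : ℝ} (hκ : 0 ≤ κ) (hK : 0 ≤ K) (hr : 0 ≤ r) (hu : 0 ≤ u) :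
    min (κ * r) (K * u) ≤ (κ + K) * min r u := by
  rcases le_total r u with h | h
  · rw [min_eq_left h]
    exact (min_le_left _ _).trans (by gcongr; linarith)
  · rw [min_eq_right h]
    exact (min_le_right _ _).trans (by gcongr; linarith)

theorem abs_pow_mul_le_abs_pow_sub_one {l : ℝ} (hl : 1 < |l|) {n : ℕ} (hn : 1 ≤ n) :
    |l| ^ n * (1 - |l|⁻¹) ≤ |l ^ n - 1| := by
  have h1 : |l| ^ n - 1 ≤ |l ^ n - 1| := by
    have := abs_sub_abs_le_abs_sub (l ^ n) 1
    rwa [abs_pow, abs_one] at this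
  have h2 : 1 ≤ |l| ^ n * |l|⁻¹ := by
    rw [← div_eq_mul_inv, one_le_div (by linarith)]
    exact le_self_pow₀ hl.le (by omega)
  linarith

theorem one_sub_abs_le_abs_pow_sub_one {l : ℝ} (hl : |l| < 1) {n : ℕ} (hn : 1 ≤ n) :
    1 - |l| ≤ |l ^ n - 1| := by
  have h1 : 1 - |l| ^ n ≤ |l ^ n - 1| := by
    have := abs_sub_abs_le_abs_sub 1 (l ^ n)
    rwa [abs_pow, abs_one, abs_sub_comm] at this
  have h2 : |l| ^ n ≤ |l| := pow_le_of_le_one (abs_nonneg _) hl.le (by omega)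
  linarith

variable {l₁ l₂ : ℝ} {Φ : EuclideanSpace ℝ (Fin 2) ≃L[ℝ] ℝ × ℝ}

theorem map_displacement
    (hΦ : ∀ (n : ℕ) x, Φ (Matrix.toEuclideanLin ((A ^ n).map (Int.cast : ℤ → ℝ)) x) =
      (l₂ ^ n * (Φ x).1, l₁ ^ n * (Φ x).2)) (n : ℕ) (x : EuclideanSpace ℝ (Fin 2)) :
    Φ (displacement A n x) = ((l₂ ^ n - 1) * (Φ x).1, (l₁ ^ n - 1) * (Φ x).2) := by
  rw [displacement_apply, map_sub, hΦ]
  ext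
  · simp only [Prod.fst_sub]; ring
  · simp only [Prod.snd_sub]; ring

theorem exists_lintegral_ball_bump_le
    (hΦ : ∀ (n : ℕ) x, Φ (Matrix.toEuclideanLin ((A ^ n).map (Int.cast : ℤ → ℝ)) x) =
      (l₂ ^ n * (Φ x).1, l₁ ^ n * (Φ x).2))
    (hp : ∀ z w : Fin 2 → ℤ, z ≠ w →
      1 ≤ |(Φ (intVec z)).1 - (Φ (intVec w)).1| * |(Φ (intVec z)).2 - (Φ (intVec w)).2|)
    (h1 : |l₁| < 1) (h2 : 1 < |l₂|) {τ : ℝ} (hτ : 0 < τ)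
    (T : EuclideanSpace ℝ (Fin 2) ≃L[ℝ] EuclideanSpace ℝ (Fin 2)) (b : EuclideanSpace ℝ (Fin 2)) :
    ∃ C : ℝ≥0, ∀ n : ℕ, 1 ≤ n → ∀ ψ : (Fin 2 → UnitAddCircle) → ℝ≥0,
      (∀ t, (ψ t : ℝ≥0∞) ≤ ENNReal.ofReal (2 / (Real.exp (-(n : ℝ) * τ) / 2) ^ 2)) →
      (∀ t, Real.exp (-(n : ℝ) * τ) / 2 ≤ ‖t‖ → ψ t = 0) → ∀ x r, 0 < r → r ≤ 1 →
      ∫⁻ y in Metric.ball x r, ψ (torusProj (displacement A n (T y + b))) ≤ C * ENNReal.ofReal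
        (r ^ min (2 * Real.log |l₂| / (τ + Real.log |l₂|)) (Real.log |l₂| / τ)) := by
  set L := Real.log |l₂| with hL
  have hL0 : 0 < L := Real.log_pos h2
  set s := min (2 * L / (τ + L)) (L / τ) with hs
  have hs2 : s ≤ 2 := (min_le_left _ _).trans (by rw [div_le_iff₀ (by positivity)]; linarith)
  obtain ⟨D, κ, hκ, hD⟩ := exists_measure_ball_inter_preimage_le volume (T.trans Φ) hp
  obtain ⟨K, hK, hKΦ⟩ := Φ.toContinuousLinearMap.bound
  have hδ₁ : 0 < 1 - |l₁| := by linarith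
  have hδ₂ : 0 < 1 - |l₂|⁻¹ := by linarith [inv_lt_one_of_one_lt₀ h2]
  set δ₁ := 1 - |l₁|
  set δ₂ := 1 - |l₂|⁻¹
  set C := 8 * (K ^ 2 * κ ^ 2 + (κ + K / δ₂) * (κ + K / δ₁)) with hC
  have hC0 : 0 ≤ C := by positivity
  refine ⟨D * C.toNNReal, fun n hn ψ hψ hψ0 x r hr hr1 => ?_⟩
  set e := Real.exp (-(n : ℝ) * τ) with he
  have he0 : 0 < e := Real.exp_pos _
  have hα : |l₂| ^ n * δ₂ ≤ |l₂ ^ n - 1| := abs_pow_mul_le_abs_pow_sub_one h2 hn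
  have hβ : δ₁ ≤ |l₁ ^ n - 1| := one_sub_abs_le_abs_pow_sub_one h1 hn
  have hα0 : 0 < |l₂ ^ n - 1| := lt_of_lt_of_le (by positivity) hα
  have hβ0 : 0 < |l₁ ^ n - 1| := lt_of_lt_of_le (by positivity) hβ
  have hexp : Real.exp (n * L) = |l₂| ^ n := by
    rw [Real.exp_nat_mul, hL, Real.exp_log (by linarith)]
  set q := Φ (displacement A n b)
  set S := {y | y ∈ Metric.ball x r ∧ ∃ z : Fin 2 → ℤ,
    |(l₂ ^ n - 1) * (T.trans Φ y).1 + q.1 - (Φ (intVec z)).1| ≤ K * e ∧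
    |(l₁ ^ n - 1) * (T.trans Φ y).2 + q.2 - (Φ (intVec z)).2| ≤ K * e} with hS
  have hSμ := hD q (l₂ ^ n - 1) (l₁ ^ n - 1) (K * e) r x (abs_pos.1 hα0) (abs_pos.1 hβ0)
    (by positivity) hr
  have hpt : ∀ y, (Metric.ball x r).indicator
      (fun y => (ψ (torusProj (displacement A n (T y + b))) : ℝ≥0∞)) y ≤
      S.indicator (fun _ => ENNReal.ofReal (2 / (e / 2) ^ 2)) y := by
    intro y
    by_cases hy : y ∈ Metric.ball x r
    swap
    · rw [Set.indicator_of_notMem hy]; exact zero_le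
    by_cases hy0 : ψ (torusProj (displacement A n (T y + b))) = 0
    · rw [Set.indicator_of_mem hy, hy0]; exact zero_le
    have hlt : ‖torusProj (displacement A n (T y + b))‖ < e / 2 := by
      by_contra h
      exact hy0 (hψ0 _ (not_lt.1 h))
    obtain ⟨z, hz⟩ := exists_norm_sub_intVec_le (displacement A n (T y + b))
    have h3 : √2 ≤ 2 := ((Real.sqrt_lt' (by norm_num)).2 (by norm_num)).le
    have hz' : ‖displacement A n (T y + b) - intVec z‖ ≤ e := by
      refine hz.trans ?_
      calc √2 * ‖torusProj (displacement A n (T y + b))‖ ≤ 2 * (e / 2) := by gcongr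
        _ = e := by ring
    have hΦz : ‖Φ (displacement A n (T y + b)) - Φ (intVec z)‖ ≤ K * e := by
      rw [← map_sub]
      exact (hKΦ _).trans (by gcongr)
    have hexpand : Φ (displacement A n (T y + b)) =
        ((l₂ ^ n - 1) * (T.trans Φ y).1 + q.1, (l₁ ^ n - 1) * (T.trans Φ y).2 + q.2) := by
      rw [map_add, map_add, map_displacement hΦ]
      rfl
    rw [hexpand] at hΦz
    have hyS : y ∈ S := ⟨hy, z, (norm_fst_le _).trans hΦz, (norm_snd_le _).trans hΦz⟩
    rw [Set.indicator_of_mem hy, Set.indicator_of_mem hyS]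
    exact hψ _
  have hreal : 2 / (e / 2) ^ 2 * ((K * e) ^ 2 * (κ * r) ^ 2 +
      min (κ * r) (K * e / |l₂ ^ n - 1|) * min (κ * r) (K * e / |l₁ ^ n - 1|)) ≤ C * r ^ s := by
    have hA : min (κ * r) (K * e / |l₂ ^ n - 1|) ≤
        (κ + K / δ₂) * min r (e / Real.exp (n * L)) := by
      refine le_trans (min_le_min_left _ ?_)
        (min_mul_mul_le hκ.le (by positivity) hr.le (by positivity))
      rw [hexp, div_mul_div_comm]
      gcongr
      linarith
    have hB : min (κ * r) (K * e / |l₁ ^ n - 1|) ≤ (κ + K / δ₁) * min r e := by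
      refine le_trans (min_le_min_left _ ?_)
        (min_mul_mul_le hκ.le (by positivity) hr.le he0.le)
      rw [div_mul_eq_mul_div]
      gcongr
    have hAB : min (κ * r) (K * e / |l₂ ^ n - 1|) * min (κ * r) (K * e / |l₁ ^ n - 1|) ≤
        (κ + K / δ₂) * (κ + K / δ₁) * (r ^ s * e ^ 2) := by
      calc _ ≤ ((κ + K / δ₂) * min r (e / Real.exp (n * L))) * ((κ + K / δ₁) * min r e) := by
            gcongr
        _ = (κ + K / δ₂) * (κ + K / δ₁) * (min r (e / Real.exp (n * L)) * min r e) := by ring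
        _ ≤ _ := by
            refine mul_le_mul_of_nonneg_left ?_ (by positivity)
            exact min_mul_min_le_rpow hτ hL0 hr n
    have hr2 : r ^ 2 ≤ r ^ s := by
      rw [← Real.rpow_two]
      exact Real.rpow_le_rpow_of_exponent_ge hr hr1 hs2
    calc _ ≤ 2 / (e / 2) ^ 2 * (K ^ 2 * κ ^ 2 * (r ^ s * e ^ 2) +
          (κ + K / δ₂) * (κ + K / δ₁) * (r ^ s * e ^ 2)) := by
          refine mul_le_mul_of_nonneg_left (add_le_add ?_ hAB) (by positivity)
          calc (K * e) ^ 2 * (κ * r) ^ 2 = K ^ 2 * κ ^ 2 * (r ^ 2 * e ^ 2) := by ring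
            _ ≤ _ := by gcongr
      _ = C * r ^ s := by
          rw [hC]
          field_simp
          ring
  calc ∫⁻ y in Metric.ball x r, ψ (torusProj (displacement A n (T y + b)))
      = ∫⁻ y, (Metric.ball x r).indicator
        (fun y => (ψ (torusProj (displacement A n (T y + b))) : ℝ≥0∞)) y :=
        (lintegral_indicator measurableSet_ball _).symm
    _ ≤ ∫⁻ y, S.indicator (fun _ => ENNReal.ofReal (2 / (e / 2) ^ 2)) y := lintegral_mono hpt
    _ ≤ ENNReal.ofReal (2 / (e / 2) ^ 2) * volume S := lintegral_indicator_const_le _ _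
    _ ≤ ENNReal.ofReal (2 / (e / 2) ^ 2) * (D * ENNReal.ofReal ((K * e) ^ 2 * (κ * r) ^ 2 +
      min (κ * r) (K * e / |l₂ ^ n - 1|) * min (κ * r) (K * e / |l₁ ^ n - 1|))) :=
        mul_le_mul_right hSμ _
    _ ≤ D * ENNReal.ofReal (C * r ^ s) := by
        rw [mul_left_comm, ← ENNReal.ofReal_mul (by positivity)]
        exact mul_le_mul_right (ENNReal.ofReal_le_ofReal hreal) _
    _ = (D * C.toNNReal : ℝ≥0) * ENNReal.ofReal (r ^ s) := by
        rw [ENNReal.ofReal_mul hC0, ENNReal.coe_mul, mul_assoc]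
        rfl

theorem eventually_exists_measure_average_eq
    (hΦ : ∀ (n : ℕ) x, Φ (Matrix.toEuclideanLin ((A ^ n).map (Int.cast : ℤ → ℝ)) x) =
      (l₂ ^ n * (Φ x).1, l₁ ^ n * (Φ x).2))
    (hA : A.det ≠ 0) (h1 : |l₁| < 1) (h2 : 1 < |l₂|)
    (T : EuclideanSpace ℝ (Fin 2) ≃L[ℝ] EuclideanSpace ℝ (Fin 2)) (b : EuclideanSpace ℝ (Fin 2))
    {η : ℝ} (hη : 0 < η) :
    ∀ᶠ n : ℕ in atTop, ∀ ψ : (Fin 2 → UnitAddCircle) → ℝ≥0, Continuous ψ →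
      ∃ ν : Measure (EuclideanSpace ℝ (Fin 2)), IsProbabilityMeasure ν ∧ (∀ᵐ t ∂ν, ‖t‖ ≤ η) ∧
        ∀ x, ∫⁻ t, ψ (torusProj (displacement A n (T (x + t) + b))) ∂ν = ∫⁻ t, ψ t := by
  obtain ⟨K, hK, hKΦ⟩ := Φ.toContinuousLinearMap.bound
  obtain ⟨K', hK', hKΦ'⟩ := (T.trans Φ).symm.toContinuousLinearMap.bound
  set ε := η / (K' * (K * √2)) with hε
  have hε0 : 0 < ε := by positivity
  have hδ : 0 < 1 - |l₁| := by linarith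
  obtain ⟨m, hm⟩ := exists_pow_lt_of_lt_one (mul_pos hε0 hδ) h1
  have htop : Tendsto (fun n : ℕ => ε * (|l₂| ^ n * (1 - |l₂|⁻¹))) atTop atTop := by
    refine Tendsto.const_mul_atTop hε0 (Tendsto.atTop_mul_const ?_
      (tendsto_pow_atTop_atTop_of_one_lt h2))
    linarith [inv_lt_one_of_one_lt₀ h2]
  filter_upwards [eventually_ge_atTop 1, htop.eventually_ge_atTop (|l₂| ^ m)] with n hn hnm ψ hψ
  have hα := abs_pow_mul_le_abs_pow_sub_one h2 hn
  have hβ := one_sub_abs_le_abs_pow_sub_one h1 hn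
  have hβ0 : 0 < |l₁ ^ n - 1| := hδ.trans_le hβ
  have hα0 : 0 < |l₂ ^ n - 1| := lt_of_lt_of_le
    (mul_pos (by positivity) (by linarith [inv_lt_one_of_one_lt₀ h2])) hα
  have hγ₂ : |l₂ ^ m / (l₂ ^ n - 1)| ≤ ε := by
    rw [abs_div, abs_pow, div_le_iff₀ hα0]
    exact hnm.trans (by gcongr)
  have hγ₁ : |l₁ ^ m / (l₁ ^ n - 1)| ≤ ε := by
    rw [abs_div, abs_pow, div_le_iff₀ hβ0]
    exact hm.le.trans (by gcongr)
  set P : Measure (Fin 2 → ℝ) := Measure.pi fun _ => volume.restrict (Set.Ioc (0 : ℝ) 1) with hP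
  have : IsProbabilityMeasure (volume.restrict (Set.Ioc (0 : ℝ) 1)) := ⟨by simp⟩
  let W : (Fin 2 → ℝ) → EuclideanSpace ℝ (Fin 2) := fun s => (T.trans Φ).symm
    (l₂ ^ m / (l₂ ^ n - 1) * (Φ (WithLp.toLp 2 s)).1, l₁ ^ m / (l₁ ^ n - 1) * (Φ (WithLp.toLp 2 s)).2)
  have hW : Continuous W := by fun_prop
  refine ⟨P.map W, Measure.isProbabilityMeasure_map hW.aemeasurable, ?_, fun x => ?_⟩
  · rw [ae_map_iff hW.aemeasurable (measurableSet_le measurable_norm measurable_const), hP,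
      ← Measure.restrict_pi_pi]
    filter_upwards [ae_restrict_mem (MeasurableSet.univ_pi fun _ => measurableSet_Ioc)] with s hs
    have hs' : ‖WithLp.toLp 2 s‖ ≤ √2 := by
      rw [EuclideanSpace.norm_eq]
      refine Real.sqrt_le_sqrt ?_
      have hi : ∀ i, ‖s i‖ ^ 2 ≤ 1 := fun i => by
        have := hs i trivial
        rw [Real.norm_of_nonneg this.1.le]
        exact pow_le_one₀ this.1.le this.2
      rw [Fin.sum_univ_two]
      linarith [hi 0, hi 1]
    have hΦs : ‖Φ (WithLp.toLp 2 s)‖ ≤ K * √2 := (hKΦ _).trans (by gcongr)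
    calc ‖W s‖ ≤ K' * ‖(l₂ ^ m / (l₂ ^ n - 1) * (Φ (WithLp.toLp 2 s)).1,
          l₁ ^ m / (l₁ ^ n - 1) * (Φ (WithLp.toLp 2 s)).2)‖ := hKΦ' _
      _ ≤ K' * (ε * (K * √2)) := by
          refine mul_le_mul_of_nonneg_left (norm_prod_le_iff.2 ⟨?_, ?_⟩) hK'.le
          · rw [norm_mul]
            exact mul_le_mul hγ₂ ((norm_fst_le _).trans hΦs) (norm_nonneg _) hε0.le
          · rw [norm_mul]
            exact mul_le_mul hγ₁ ((norm_snd_le _).trans hΦs) (norm_nonneg _) hε0.le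
      _ = η := by rw [hε]; field_simp
  · rw [lintegral_map (by fun_prop) hW.measurable,
      ← lintegral_add_toralEnd_coe (B := A ^ m) (by rw [Matrix.det_pow]; exact pow_ne_zero _ hA) hψ
        (torusProj (displacement A n (T x + b)))]
    refine lintegral_congr fun s => ?_
    have hTW : displacement A n (T (W s)) =
        Matrix.toEuclideanLin ((A ^ m).map (Int.cast : ℤ → ℝ)) (WithLp.toLp 2 s) := by
      apply Φ.injective
      have hΦW : Φ (T (W s)) = (l₂ ^ m / (l₂ ^ n - 1) * (Φ (WithLp.toLp 2 s)).1,
          l₁ ^ m / (l₁ ^ n - 1) * (Φ (WithLp.toLp 2 s)).2) := (T.trans Φ).apply_symm_apply _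
      rw [map_displacement hΦ, hΦ, hΦW]
      have := abs_pos.1 hα0
      have := abs_pos.1 hβ0
      ext
      · simp only; field_simp
      · simp only; field_simp
    rw [map_add T, add_right_comm, map_add, hTW, torusProj_add, toralEnd_coe]
    rfl

end Return

theorem exists_isOpen_recSet_eq_iInter (A : Matrix (Fin 2) (Fin 2) ℤ) (τ : ℝ) :
    ∃ G : ℕ → Set (EuclideanSpace ℝ (Fin 2)),
      (∀ k, IsOpen (G k)) ∧ recSet A τ = ⋂ k, G k := by
  refine ⟨fun k => ⋃ n ≥ k, ⋃ z : Fin 2 → ℤ,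
    {x | ‖displacement A n x - intVec z‖ < Real.exp (-(n : ℝ) * τ)}, fun k => ?_, ?_⟩
  · exact isOpen_biUnion fun n _ => isOpen_iUnion fun z =>
      isOpen_lt (by fun_prop) continuous_const
  · ext x
    simp [recSet, frequently_atTop, displacement_apply]

theorem ofReal_le_dimH_iInter_image_recSet {A : Matrix (Fin 2) (Fin 2) ℤ} {l₁ l₂ : ℝ}
    (hsum : l₁ + l₂ = (A.trace : ℝ)) (hprod : l₁ * l₂ = (A.det : ℝ))
    (h0 : 0 < |l₁|) (h1 : |l₁| < 1) (h2 : 1 < |l₂|) {τ : ℝ} (hτ : 0 < τ)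
    {f : ℕ → EuclideanSpace ℝ (Fin 2) → EuclideanSpace ℝ (Fin 2)}
    (hf : ∀ i, ∃ c > (0 : ℝ), ∀ x y, dist (f i x) (f i y) = c * dist x y) {s : ℝ} (hs : 0 < s)
    (hss : s < min (2 * Real.log |l₂| / (τ + Real.log |l₂|)) (Real.log |l₂| / τ)) :
    ENNReal.ofReal s ≤ dimH (⋂ i, f i '' recSet A τ) := by
  obtain ⟨Φ, hΦ, hp⟩ := exists_eigen_coordinates hsum hprod h0 h1 h2
  have hA : A.det ≠ 0 := by
    have : l₁ * l₂ ≠ 0 := mul_ne_zero (abs_pos.1 h0) (abs_pos.1 (by linarith))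
    rw [hprod] at this
    exact_mod_cast this
  have hlog : 0 < Real.log |l₂| := Real.log_pos h2
  have hs2 : s ≤ 2 := hss.le.trans ((min_le_left _ _).trans
    (by rw [div_le_iff₀ (by positivity)]; linarith))
  choose T b hTb using fun i => (hf i).elim fun c hc => exists_rightInverse_of_dist_eq hc.1 hc.2
  choose ψ hψc hψ1 hψle hψ0 using fun n : ℕ => exists_continuous_torus_bump
    (ρ := Real.exp (-(n : ℝ) * τ) / 2) (by positivity) (by
      have : Real.exp (-(n : ℝ) * τ) ≤ 1 := Real.exp_le_one_iff.2 (by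
        rw [neg_mul]; exact neg_nonpos.2 (by positivity))
      linarith)
  let g : ℕ → ℕ → EuclideanSpace ℝ (Fin 2) → EuclideanSpace ℝ (Fin 2) :=
    fun i n y => displacement A n (T i y + b i)
  have hg : ∀ i n, Continuous (g i n) := fun i n => by fun_prop
  have hmain := le_dimH_setOf_forall_frequently_mem
    (volume : Measure (EuclideanSpace ℝ (Fin 2))) hs hss (by simpa using hs2)
    (V := fun i n => {y | ∃ z, ‖g i n y - intVec z‖ < Real.exp (-(n : ℝ) * τ)})
    (h := fun i n y => ψ n (torusProj (g i n y)))
    (fun i n => (hψc n).comp (continuous_torusProj.comp (hg i n)))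
    (fun i n => tsupport_comp_torusProj_subset (Real.exp_pos _) (hψ0 n) (hg i n))
    (fun i => by
      obtain ⟨C, hC⟩ := exists_lintegral_ball_bump_le hΦ hp h1 h2 hτ (T i) (b i)
      refine ⟨C, ?_⟩
      filter_upwards [eventually_ge_atTop 1] with n hn x r hr hr1
      exact hC n hn (ψ n) (hψle n) (hψ0 n) x r hr hr1)
    (fun i η hη => by
      filter_upwards [eventually_exists_measure_average_eq hΦ hA h1 h2 (T i) (b i) hη] with n hn
      obtain ⟨ν, hν, hνη, hav⟩ := hn (ψ n) (hψc n)
      exact ⟨ν, hν, hνη, fun x => (hav x).trans (hψ1 n)⟩)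
  refine hmain.trans (dimH_mono fun y hy => Set.mem_iInter.2 fun i => ?_)
  exact ⟨T i y + b i, hy i, hTb i y⟩

end Auxiliary

/-- `R_τ` is in Falconer's class `𝒢^{s₀}(𝕋²)` with
`s₀ = min{2log|λ₂|/(τ+log|λ₂|), log|λ₂|/τ}`: (the lift of) `R_τ` is a `G_δ`
set and any countable intersection of images of it under similarity maps has
Hausdorff dimension at least `s₀`. -/
theorem recSet_large_intersection (A : Matrix (Fin 2) (Fin 2) ℤ) (l₁ l₂ : ℝ)
    (hsum : l₁ + l₂ = (A.trace : ℝ)) (hprod : l₁ * l₂ = (A.det : ℝ))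
    (h0 : 0 < |l₁|) (h1 : |l₁| < 1) (h2 : 1 < |l₂|)
    (τ : ℝ) (hτ : 0 < τ) :
    (∃ G : ℕ → Set (EuclideanSpace ℝ (Fin 2)),
      (∀ k, IsOpen (G k)) ∧ recSet A τ = ⋂ k, G k) ∧
    ∀ f : ℕ → (EuclideanSpace ℝ (Fin 2) → EuclideanSpace ℝ (Fin 2)),
      (∀ i, ∃ c > (0 : ℝ), ∀ x y, dist (f i x) (f i y) = c * dist x y) →
      ENNReal.ofReal
          (min (2 * Real.log |l₂| / (τ + Real.log |l₂|)) (Real.log |l₂| / τ))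
        ≤ dimH (⋂ i, f i '' recSet A τ) := by
  refine ⟨exists_isOpen_recSet_eq_iInter A τ, fun f hf => ?_⟩
  refine le_of_forall_lt fun a ha => ?_
  have ha' : a ≠ ⊤ := ne_top_of_lt ha
  have hlt : a.toReal < min (2 * Real.log |l₂| / (τ + Real.log |l₂|)) (Real.log |l₂| / τ) :=
    (ENNReal.lt_ofReal_iff_toReal_lt ha').1 ha
  obtain ⟨s, has, hs⟩ := exists_between hlt
  have hs0 : 0 < s := ENNReal.toReal_nonneg.trans_lt has
  exact ((ENNReal.lt_ofReal_iff_toReal_lt ha').2 has).trans_le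
    (ofReal_le_dimH_iInter_image_recSet hsum hprod h0 h1 h2 hτ hf hs0 hs)
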